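/- Let G be a concurrent stochastic game with countable state set S, a sink target state ⊤, and with B(s) finite for every s ∈ S. Let v_∞(s) := lim_{n→∞} v_n(s) be the limit of the horizon-restricted values. Then for all s ∈ S: v_∞(s) = sup_{α ∈ D(A(s))} min_{b ∈ B(s)} ⟨p(s,α,b), v_∞⟩. -/

import Mathlib

open scoped ENNReal Classical

/-- One step of a play: a state together with the actions chosen by Max and Min there. -/
structure Step (S A B : Type) where
  st : S
  ac : A
  bc : B

instance {S A B : Type} : MeasurableSpace (Step S A B) := ⊤

/-- A history: the list of past steps together with the current (final) state. -/
abbrev Hist (S A B : Type) := List (Step S A B) × S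

/-- An infinite play. -/
abbrev Play (S A B : Type) := ℕ → Step S A B

/-- A concurrent stochastic game: action sets for Max and Min at each state
(nonempty; countability is imposed via `Countable` instances on `S`, `A`, `B`),
and a transition probability distribution for each state and pair of actions. -/
structure Game (S A B : Type) where
  actA : S → Set A
  actB : S → Set B
  actA_nonempty : ∀ s, (actA s).Nonempty
  actB_nonempty : ∀ s, (actB s).Nonempty
  p : S → A → B → PMF S

namespace Game

variable {S A B : Type}

/-- A Max strategy assigns to each history a mixed action on the Max actions
available at the final state of the history. -/
def IsMaxStrategy (G : Game S A B) (σ : Hist S A B → PMF A) : Prop :=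
  ∀ h : Hist S A B, (σ h).support ⊆ G.actA h.2

/-- A Min strategy assigns to each history a mixed action on the Min actions
available at the final state of the history. -/
def IsMinStrategy (G : Game S A B) (π : Hist S A B → PMF B) : Prop :=
  ∀ h : Hist S A B, (π h).support ⊆ G.actB h.2

/-- A sink state: all transitions from it return to it with probability 1. -/
def IsSink (G : Game S A B) (s : S) : Prop := ∀ a b, G.p s a b s = 1

/-- A history is valid if all actions taken in it were available. -/
def ValidHist (G : Game S A B) (h : Hist S A B) : Prop :=
  ∀ z ∈ h.1, z.ac ∈ G.actA z.st ∧ z.bc ∈ G.actB z.st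

/-- Transition function extended to a mixed Max action and a pure Min action. -/
noncomputable def pA (G : Game S A B) (s : S) (α : PMF A) (b : B) : PMF S :=
  α.bind fun a => G.p s a b

/-- Transition function extended to mixed actions of both players. -/
noncomputable def pAB (G : Game S A B) (s : S) (α : PMF A) (β : PMF B) : PMF S :=
  α.bind fun a => β.bind fun b => G.p s a b

/-- The state reached after the current position: the state of the next listed
step, or the given final state if no steps remain. -/
def nextState : List (Step S A B) → S → S
  | [], t => t
  | z :: _, _ => z.st

/-- Auxiliary recursion computing the probability of a history:
`pre` is the already-consumed prefix, `cur` the current state, and the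
remaining steps and final state are processed from the left. -/
noncomputable def histProbAux (G : Game S A B)
    (σ : Hist S A B → PMF A) (π : Hist S A B → PMF B) :
    List (Step S A B) → S → List (Step S A B) → S → ℝ≥0∞
  | _, cur, [], t => if t = cur then 1 else 0
  | pre, cur, z :: rest, t =>
    if z.st = cur then
      σ (pre, cur) z.ac * π (pre, cur) z.bc *
        G.p z.st z.ac z.bc (nextState rest t) *
        histProbAux G σ π (pre ++ [z]) (nextState rest t) rest t
    else 0

/-- The probability of (the cylinder of) a history under strategies σ, π from
initial state `s0`. -/
noncomputable def histProb (G : Game S A B)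
    (σ : Hist S A B → PMF A) (π : Hist S A B → PMF B) (s0 : S) (h : Hist S A B) : ℝ≥0∞ :=
  G.histProbAux σ π [] s0 h.1 h.2

end Game

/-- The cylinder set of plays extending a given history. -/
def cylinder {S A B : Type} (h : Hist S A B) : Set (Play S A B) :=
  {ω | (∀ i : Fin h.1.length, ω i = h.1.get i) ∧ (ω h.1.length).st = h.2}

/-- A strategy is memoryless if its choice depends only on the final state. -/
def Memoryless {S A B X : Type} (σ : Hist S A B → X) : Prop :=
  ∀ h h' : Hist S A B, h.2 = h'.2 → σ h = σ h'

/-- The event that the play visits state `t`. -/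
def Reaches {S A B : Type} (t : S) : Set (Play S A B) := {ω | ∃ i, (ω i).st = t}

/-- The event that the play never visits state `t`. -/
def Avoids {S A B : Type} (t : S) : Set (Play S A B) := {ω | ∀ i, (ω i).st ≠ t}

/-- The event that the play visits state `t` within at most `n` steps. -/
def ReachesWithin {S A B : Type} (t : S) (n : ℕ) : Set (Play S A B) :=
  {ω | ∃ i ≤ n, (ω i).st = t}

/-- Expectation of `v : S → ℝ≥0∞` with respect to a distribution on `S`. -/
noncomputable def expE {S : Type} (μ : PMF S) (v : S → ℝ≥0∞) : ℝ≥0∞ := ∑' t, μ t * v t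

/-- Expectation of a real-valued `v` with respect to a distribution on `S`. -/
noncomputable def expR {S : Type} (μ : PMF S) (v : S → ℝ) : ℝ := ∑' t, (μ t).toReal * v t

/-- The mass a distribution assigns to a set of states. -/
noncomputable def massOf {S : Type} (μ : PMF S) (T : Set S) : ℝ≥0∞ :=
  ∑' t, T.indicator (⇑μ) t

namespace Game

variable {S A B : Type}

/-- `μ` is the probability measure on plays induced by strategies σ, π from
initial state `s0` (characterized on cylinder sets, by Carathéodory's
extension theorem). -/
def IsPlayMeasure (G : Game S A B) (σ : Hist S A B → PMF A) (π : Hist S A B → PMF B)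
    (s0 : S) (μ : MeasureTheory.Measure (Play S A B)) : Prop :=
  MeasureTheory.IsProbabilityMeasure μ ∧
    ∀ h : Hist S A B, μ (cylinder h) = G.histProb σ π s0 h

/-- The (lower) value `sup_σ inf_π P_{s,σ,π}(E)` of objective `E` from state `s`,
relative to the family `P` of induced play measures. -/
noncomputable def val (G : Game S A B)
    (P : (Hist S A B → PMF A) → (Hist S A B → PMF B) → S →
      MeasureTheory.Measure (Play S A B))
    (E : Set (Play S A B)) (s : S) : ℝ≥0∞ :=
  ⨆ σ ∈ {σ | G.IsMaxStrategy σ}, ⨅ π ∈ {π | G.IsMinStrategy π}, P σ π s E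

/-- The set of states from which Max has an optimal strategy for `Reaches top`. -/
def OptStates (G : Game S A B)
    (P : (Hist S A B → PMF A) → (Hist S A B → PMF B) → S →
      MeasureTheory.Measure (Play S A B))
    (top : S) : Set S :=
  {s | ∃ σ, G.IsMaxStrategy σ ∧ ∀ π, G.IsMinStrategy π →
      P σ π s (Reaches top) ≥ G.val P (Reaches top) s}

/-- A mixed Max action `α` at `s` is optimality-preserving if every Min action
gives expected value at least the value of `s`, and in case of equality the
successor distribution is supported on states admitting optimal strategies. -/
def OptPreserving (G : Game S A B)
    (P : (Hist S A B → PMF A) → (Hist S A B → PMF B) → S →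
      MeasureTheory.Measure (Play S A B))
    (top : S) (s : S) (α : PMF A) : Prop :=
  ∀ b ∈ G.actB s,
    G.val P (Reaches top) s ≤ expE (G.pA s α b) (G.val P (Reaches top)) ∧
    (expE (G.pA s α b) (G.val P (Reaches top)) = G.val P (Reaches top) s →
      (G.pA s α b).support ⊆ G.OptStates P top)

/-- A Min action `b` is value-preserving at `s` against the mixed action `α`. -/
def ValuePres (G : Game S A B)
    (P : (Hist S A B → PMF A) → (Hist S A B → PMF B) → S →
      MeasureTheory.Measure (Play S A B))
    (top : S) (s : S) (α : PMF A) (b : B) : Prop :=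
  expE (G.pA s α b) (G.val P (Reaches top)) = G.val P (Reaches top) s

end Game

open MeasureTheory hiding cylinder

/-- A step is a triple of a state and two actions. -/
def Step.equivProd (S A B : Type) : Step S A B ≃ S × A × B where
  toFun z := (z.st, z.ac, z.bc)
  invFun x := ⟨x.1, x.2.1, x.2.2⟩
  left_inv _ := rfl
  right_inv _ := rfl

instance Step.instCountable {S A B : Type} [Countable S] [Countable A] [Countable B] :
    Countable (Step S A B) :=
  (Step.equivProd S A B).injective.countable

section Cylinder

variable {S A B : Type}

lemma measurableSet_st_eq (n : ℕ) (t : S) :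
    MeasurableSet {ω : Play S A B | (ω n).st = t} :=
  have h : MeasurableSet {z : Step S A B | z.st = t} := trivial
  h.preimage (measurable_pi_apply n)

lemma measurableSet_cylinder (h : Hist S A B) : MeasurableSet (cylinder h) := by
  have hi (i : Fin h.1.length) : MeasurableSet {z : Step S A B | z = h.1.get i} := trivial
  have hpre (i : Fin h.1.length) : MeasurableSet {ω : Play S A B | ω i = h.1.get i} :=
    (hi i).preimage (measurable_pi_apply i.1)
  have heq : cylinder h = (⋂ i : Fin h.1.length, {ω | ω i = h.1.get i}) ∩
      {ω | (ω h.1.length).st = h.2} := by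
    ext ω
    simp [cylinder]
  rw [heq]
  exact (MeasurableSet.iInter hpre).inter (measurableSet_st_eq _ _)

lemma mem_cylinder_ofFn {n : ℕ} {f : Fin n → Step S A B} {t : S} {ω : Play S A B} :
    ω ∈ cylinder (List.ofFn f, t) ↔ (∀ i : Fin n, ω i = f i) ∧ (ω n).st = t := by
  simp only [cylinder, Set.mem_ofPred_eq, List.length_ofFn, List.get_ofFn]
  refine and_congr_left fun _ => ⟨fun h i => ?_, fun h i => h (i.cast (by simp))⟩
  simpa using h (i.cast (by simp))

lemma iUnion_cylinder_ofFn (n : ℕ) (t : S) :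
    ⋃ f : Fin n → Step S A B, cylinder (List.ofFn f, t) = {ω | (ω n).st = t} := by
  ext ω
  simp only [Set.mem_iUnion, mem_cylinder_ofFn, Set.mem_ofPred_eq]
  exact ⟨fun ⟨_, h⟩ => h.2, fun h => ⟨fun i => ω i, fun _ => rfl, h⟩⟩

lemma pairwise_disjoint_cylinder_ofFn (n : ℕ) (t : S) :
    Pairwise (Function.onFun Disjoint
      fun f : Fin n → Step S A B => cylinder (List.ofFn f, t)) := by
  intro f g hfg
  refine Set.disjoint_left.2 fun ω hf hg => hfg (funext fun i => ?_)
  rw [← (mem_cylinder_ofFn.1 hf).1 i, (mem_cylinder_ofFn.1 hg).1 i]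

lemma reachesWithin_mono (t : S) :
    Monotone fun n => (ReachesWithin t n : Set (Play S A B)) :=
  fun _ _ hmn _ ⟨i, hi, h⟩ => ⟨i, hi.trans hmn, h⟩

end Cylinder

section Expectation

variable {S : Type}

lemma expE_mono {μ : PMF S} {v w : S → ℝ≥0∞} (h : v ≤ w) : expE μ v ≤ expE μ w :=
  ENNReal.tsum_le_tsum fun t => mul_le_mul_right (h t) _

lemma expE_add_const (μ : PMF S) (v : S → ℝ≥0∞) (c : ℝ≥0∞) :
    expE μ (fun t => v t + c) = expE μ v + c := by
  simp [expE, mul_add, ENNReal.tsum_add, ENNReal.tsum_mul_right, μ.tsum_coe]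

lemma expE_const (μ : PMF S) (c : ℝ≥0∞) : expE μ (fun _ => c) = c := by
  simp [expE, ENNReal.tsum_mul_right, μ.tsum_coe]

lemma expE_pure (s : S) (v : S → ℝ≥0∞) : expE (PMF.pure s) v = v s := by
  rw [expE, tsum_eq_single s fun t ht => by simp [PMF.pure_apply_of_ne _ _ ht]]
  simp

lemma expE_bind {X : Type} (α : PMF X) (q : X → PMF S) (v : S → ℝ≥0∞) :
    expE (α.bind q) v = expE α fun a => expE (q a) v := by
  simp only [expE, PMF.bind_apply, ← ENNReal.tsum_mul_right, ← ENNReal.tsum_mul_left]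
  rw [ENNReal.tsum_comm]
  simp only [mul_assoc]

lemma expE_comm {X Y : Type} (α : PMF X) (β : PMF Y) (F : X → Y → ℝ≥0∞) :
    (expE α fun a => expE β fun b => F a b) = expE β fun b => expE α fun a => F a b := by
  simp only [expE, ← ENNReal.tsum_mul_left]
  rw [ENNReal.tsum_comm]
  simp only [mul_left_comm]

lemma le_expE_of_forall_mem_support {μ : PMF S} {v : S → ℝ≥0∞} {c : ℝ≥0∞}
    (h : ∀ t ∈ μ.support, c ≤ v t) : c ≤ expE μ v := by
  rw [← expE_const μ c]
  refine ENNReal.tsum_le_tsum fun t => ?_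
  by_cases ht : μ t = 0
  · simp [ht]
  · exact mul_le_mul_right (h t ((μ.mem_support_iff t).2 ht)) _

lemma expE_iSup (μ : PMF S) {v : ℕ → S → ℝ≥0∞} (hv : Monotone v) :
    expE μ (fun t => ⨆ n, v n t) = ⨆ n, expE μ (v n) := by
  let _ : MeasurableSpace S := ⊤
  simp only [expE, ENNReal.mul_iSup, ← lintegral_count]
  exact lintegral_iSup (fun _ => measurable_from_top)
    fun m n hmn t => mul_le_mul_right (hv hmn t) _

end Expectation

namespace Game

variable {S A B : Type}

/-- The one-step operator of the game: Max picks a mixed action, Min answers with an action. -/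
noncomputable def stepValue (G : Game S A B) (v : S → ℝ≥0∞) (s : S) : ℝ≥0∞ :=
  ⨆ α ∈ {α : PMF A | α.support ⊆ G.actA s}, ⨅ b ∈ G.actB s, expE (G.pA s α b) v

/-- The iterates of the one-step operator on the indicator of the target. -/
noncomputable def horizonValue (G : Game S A B) (top : S) : ℕ → S → ℝ≥0∞
  | 0 => fun s => if s = top then 1 else 0
  | n + 1 => G.stepValue (G.horizonValue top n)

/-- The probability of being in state `t` after `n` further steps, from the history `(pre, cur)`. -/
noncomputable def stateProb (G : Game S A B) (σ : Hist S A B → PMF A) (π : Hist S A B → PMF B)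
    (t : S) (n : ℕ) (pre : List (Step S A B)) (cur : S) : ℝ≥0∞ :=
  ∑' f : Fin n → Step S A B, G.histProbAux σ π pre cur (List.ofFn f) t

variable (G : Game S A B) (σ : Hist S A B → PMF A) (π : Hist S A B → PMF B)

lemma histProbAux_eq_zero {pre : List (Step S A B)} {cur t : S} {l : List (Step S A B)}
    (h : nextState l t ≠ cur) : G.histProbAux σ π pre cur l t = 0 := by
  cases l <;> exact if_neg h

lemma histProbAux_concat_eq_zero {pre l : List (Step S A B)} {cur t : S} {z : Step S A B}
    (h : G.p z.st z.ac z.bc t = 0) : G.histProbAux σ π pre cur (l ++ [z]) t = 0 := by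
  induction l generalizing pre cur with
  | nil => simp [histProbAux, nextState, h]
  | cons y l ih => simp [histProbAux, ih]

lemma stateProb_zero (t : S) (pre : List (Step S A B)) (cur : S) :
    G.stateProb σ π t 0 pre cur = if cur = t then 1 else 0 := by
  simp [stateProb, histProbAux, eq_comm]

lemma stateProb_succ (t : S) (n : ℕ) (pre : List (Step S A B)) (cur : S) :
    G.stateProb σ π t (n + 1) pre cur =
      expE (σ (pre, cur)) fun a => expE (π (pre, cur)) fun b =>
        expE (G.p cur a b) fun s => G.stateProb σ π t n (pre ++ [⟨cur, a, b⟩]) s := by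
  have key (a : A) (b : B) :
      ∑' f : Fin n → Step S A B, G.p cur a b (nextState (List.ofFn f) t) *
        G.histProbAux σ π (pre ++ [⟨cur, a, b⟩]) (nextState (List.ofFn f) t) (List.ofFn f) t =
      expE (G.p cur a b) fun s => G.stateProb σ π t n (pre ++ [⟨cur, a, b⟩]) s := by
    simp only [expE, stateProb, ← ENNReal.tsum_mul_left]
    rw [ENNReal.tsum_comm]
    refine tsum_congr fun f => ?_
    rw [tsum_eq_single (nextState (List.ofFn f) t)]
    intro s hs
    rw [histProbAux_eq_zero G σ π hs.symm, mul_zero]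
  rw [stateProb, ← (Fin.consEquiv fun _ : Fin (n + 1) => Step S A B).tsum_eq, ENNReal.tsum_prod',
    ← (Step.equivProd S A B).symm.tsum_eq, ENNReal.tsum_prod', tsum_eq_single cur,
    ENNReal.tsum_prod']
  · simp only [← key]
    simp only [expE, ← ENNReal.tsum_mul_left]
    refine tsum_congr fun a => tsum_congr fun b => tsum_congr fun f => ?_
    simp [Fin.consEquiv, Step.equivProd, List.ofFn_succ, histProbAux, mul_assoc]
  · intro s hs
    simp [Fin.consEquiv, Step.equivProd, List.ofFn_succ, histProbAux, hs]

variable {G σ π} {s : S} {top : S}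

lemma IsPlayMeasure.measure_st_eq [Countable S] [Countable A] [Countable B]
    {μ : Measure (Play S A B)} (hμ : G.IsPlayMeasure σ π s μ) (n : ℕ) (t : S) :
    μ {ω | (ω n).st = t} = G.stateProb σ π t n [] s := by
  rw [← iUnion_cylinder_ofFn, measure_iUnion (pairwise_disjoint_cylinder_ofFn n t)
    fun _ => measurableSet_cylinder _]
  exact tsum_congr fun f => hμ.2 _

lemma IsSink.p_eq_pure (h : G.IsSink top) (a : A) (b : B) : G.p top a b = PMF.pure top := by
  have hs : (G.p top a b).support = {top} := (PMF.apply_eq_one_iff _ _).1 (h a b)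
  ext t
  by_cases ht : t = top
  · simpa [ht] using h a b
  · rw [PMF.pure_apply_of_ne _ _ ht, PMF.apply_eq_zero_iff, hs]
    exact ht

lemma IsSink.pA_eq_pure (h : G.IsSink top) (α : PMF A) (b : B) :
    G.pA top α b = PMF.pure top := by
  simp [pA, h.p_eq_pure]

lemma IsPlayMeasure.measure_leave_sink [Countable S] [Countable A] [Countable B]
    {μ : Measure (Play S A B)} (hμ : G.IsPlayMeasure σ π s μ) (htop : G.IsSink top) (n : ℕ) :
    μ {ω | (ω n).st = top ∧ (ω (n + 1)).st ≠ top} = 0 := by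
  refine measure_mono_null (t := ⋃ (f : Fin n → Step S A B) (z : Step S A B) (t : S)
    (_ : z.st = top ∧ t ≠ top), cylinder (List.ofFn f ++ [z], t)) ?_ ?_
  · intro ω hω
    simp only [Set.mem_iUnion]
    refine ⟨fun i => ω i, ω n, (ω (n + 1)).st, hω, fun i => ?_, by simp⟩
    have hi : (i : ℕ) < n + 1 := by simpa using i.2
    rcases Nat.lt_succ_iff_lt_or_eq.1 hi with h | h
    · simp [h]
    · simp [h]
  · simp only [measure_iUnion_null_iff]
    intro f z t hz
    rw [hμ.2]
    apply histProbAux_concat_eq_zero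
    rw [hz.1, htop.p_eq_pure, PMF.pure_apply_of_ne _ _ hz.2]

lemma IsPlayMeasure.measure_reachesWithin [Countable S] [Countable A] [Countable B]
    {μ : Measure (Play S A B)} (hμ : G.IsPlayMeasure σ π s μ) (htop : G.IsSink top) (n : ℕ) :
    μ (ReachesWithin top n) = G.stateProb σ π top n [] s := by
  rw [← hμ.measure_st_eq]
  refine le_antisymm ?_ (measure_mono fun ω h => ⟨n, le_rfl, h⟩)
  have hsub : ReachesWithin top n ⊆ {ω : Play S A B | (ω n).st = top} ∪
      ⋃ i, {ω | (ω i).st = top ∧ (ω (i + 1)).st ≠ top} := by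
    rintro ω ⟨i, hi, h⟩
    by_contra hω
    simp only [Set.mem_union, Set.mem_iUnion, Set.mem_ofPred_eq, not_or, not_exists, not_and,
      not_not] at hω
    exact hω.1 (Nat.le_induction h (fun j _ hj => hω.2 j hj) n hi)
  calc μ (ReachesWithin top n) ≤ _ := measure_mono hsub
    _ ≤ _ := measure_union_le _ _
    _ = μ {ω | (ω n).st = top} := by
      rw [measure_iUnion_null fun i => hμ.measure_leave_sink htop i, add_zero]

lemma stepValue_le_one {v : S → ℝ≥0∞} (hv : ∀ t, v t ≤ 1) (s : S) : G.stepValue v s ≤ 1 := by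
  obtain ⟨b, hb⟩ := G.actB_nonempty s
  refine iSup₂_le fun α _ => (iInf₂_le b hb).trans ?_
  exact (expE_mono hv).trans (expE_const _ 1).le

lemma horizonValue_le_one (n : ℕ) (s : S) : G.horizonValue top n s ≤ 1 := by
  induction n generalizing s with
  | zero => unfold horizonValue; split_ifs <;> simp
  | succ n ih => exact stepValue_le_one ih s

lemma exists_isMinStrategy_stateProb_le (hB : ∀ s, (G.actB s).Finite) (σ : Hist S A B → PMF A)
    (hσ : G.IsMaxStrategy σ) (top : S) (n : ℕ) :
    ∃ π, G.IsMinStrategy π ∧ ∀ s, G.stateProb σ π top n [] s ≤ G.horizonValue top n s := by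
  choose b hb hmin using fun h : Hist S A B =>
    Set.exists_min_image (G.actB h.2)
      (fun b => expE (G.pA h.2 (σ h) b) (G.horizonValue top (n - h.1.length - 1)))
      (hB h.2) (G.actB_nonempty h.2)
  refine ⟨fun h => PMF.pure (b h), fun h => by simpa using hb h, fun s => ?_⟩
  suffices H : ∀ (k : ℕ) (pre : List (Step S A B)) (cur : S), pre.length + k = n →
      G.stateProb σ (fun h => PMF.pure (b h)) top k pre cur ≤ G.horizonValue top k cur from
    H n [] s (by simp)
  intro k
  induction k with
  | zero => intro pre cur _; rw [stateProb_zero]; rfl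
  | succ k ih =>
    intro pre cur hk
    have hk' : n - pre.length - 1 = k := by omega
    have hmin := hmin (pre, cur)
    simp only [hk'] at hmin
    rw [stateProb_succ]
    simp only [expE_pure]
    calc _ ≤ expE (σ (pre, cur)) fun a => expE (G.p cur a (b (pre, cur)))
            (G.horizonValue top k) :=
          expE_mono fun a => expE_mono fun t => ih _ _ (by simp; omega)
      _ = expE (G.pA cur (σ (pre, cur)) (b (pre, cur))) (G.horizonValue top k) :=
          (expE_bind _ _ _).symm
      _ ≤ ⨅ b ∈ G.actB cur, expE (G.pA cur (σ (pre, cur)) b) (G.horizonValue top k) :=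
          le_iInf₂ hmin
      _ ≤ G.horizonValue top (k + 1) cur :=
          le_iSup₂_of_le (σ (pre, cur)) (hσ (pre, cur)) le_rfl

lemma exists_mixed_action_stepValue_le {v : S → ℝ≥0∞} (hv : ∀ t, v t ≤ 1) (s : S) {ε : ℝ≥0∞}
    (hε : ε ≠ 0) :
    ∃ α : PMF A, α.support ⊆ G.actA s ∧
      ∀ b ∈ G.actB s, G.stepValue v s ≤ expE (G.pA s α b) v + ε := by
  by_cases h0 : G.stepValue v s = 0
  · obtain ⟨a, ha⟩ := G.actA_nonempty s
    exact ⟨PMF.pure a, by simpa using ha, fun b _ => by simp [h0]⟩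
  · have hlt : G.stepValue v s - ε < G.stepValue v s :=
      ENNReal.sub_lt_self ((stepValue_le_one hv s).trans_lt ENNReal.one_lt_top).ne h0 hε
    obtain ⟨α, hα, h⟩ := lt_biSup_iff.1 hlt
    exact ⟨α, hα, fun b hb => tsub_le_iff_right.1 (h.le.trans (iInf₂_le b hb))⟩

lemma exists_isMaxStrategy_le_stateProb (top : S) (n : ℕ) {ε : ℝ≥0∞} (hε : ε ≠ 0) :
    ∃ σ, G.IsMaxStrategy σ ∧ ∀ π, G.IsMinStrategy π →
      ∀ s, G.horizonValue top n s ≤ G.stateProb σ π top n [] s + n * ε := by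
  choose α hα hle using fun (k : ℕ) (s : S) =>
    exists_mixed_action_stepValue_le (G := G) (horizonValue_le_one (G := G) (top := top) k) s hε
  set σ : Hist S A B → PMF A := fun h => α (n - h.1.length - 1) h.2
  refine ⟨σ, fun h => hα _ _, fun π hπ s => ?_⟩
  suffices H : ∀ (k : ℕ) (pre : List (Step S A B)) (cur : S), pre.length + k = n →
      G.horizonValue top k cur ≤ G.stateProb σ π top k pre cur + k * ε from
    H n [] s (by simp)
  intro k
  induction k with
  | zero => intro pre cur _; rw [stateProb_zero]; simp [horizonValue]
  | succ k ih =>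
    intro pre cur hk
    have hσ : σ (pre, cur) = α k cur := by
      have hk' : n - pre.length - 1 = k := by omega
      simp only [σ, hk']
    rw [stateProb_succ, hσ]
    calc G.horizonValue top (k + 1) cur
        ≤ expE (π (pre, cur)) fun b => expE (G.pA cur (α k cur) b) (G.horizonValue top k) + ε :=
          le_expE_of_forall_mem_support fun b hb => hle k cur b (hπ (pre, cur) hb)
      _ = (expE (α k cur) fun a => expE (π (pre, cur)) fun b =>
            expE (G.p cur a b) (G.horizonValue top k)) + ε := by
          rw [expE_add_const, expE_comm]
          simp only [pA, expE_bind]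
      _ ≤ (expE (α k cur) fun a => expE (π (pre, cur)) fun b => expE (G.p cur a b) fun t =>
            G.stateProb σ π top k (pre ++ [⟨cur, a, b⟩]) t + k * ε) + ε := by
          gcongr
          exact expE_mono fun a => expE_mono fun b => expE_mono fun t =>
            ih _ _ (by simp; omega)
      _ = _ := by
          simp only [expE_add_const]
          push_cast
          ring

lemma val_reachesWithin [Countable S] [Countable A] [Countable B] (htop : G.IsSink top)
    (hB : ∀ s, (G.actB s).Finite)
    {P : (Hist S A B → PMF A) → (Hist S A B → PMF B) → S → Measure (Play S A B)}
    (hP : ∀ σ π s, G.IsMaxStrategy σ → G.IsMinStrategy π → G.IsPlayMeasure σ π s (P σ π s))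
    (n : ℕ) (s : S) : G.val P (ReachesWithin top n) s = G.horizonValue top n s := by
  apply le_antisymm
  · refine iSup₂_le fun σ hσ => ?_
    obtain ⟨π, hπ, hle⟩ := exists_isMinStrategy_stateProb_le hB σ hσ top n
    refine (iInf₂_le π hπ).trans ?_
    rw [(hP σ π s hσ hπ).measure_reachesWithin htop]
    exact hle s
  · refine ENNReal.le_of_forall_pos_le_add fun ε hε _ => ?_
    have hε' : (ε : ℝ≥0∞) / (n + 1) ≠ 0 :=
      ENNReal.div_ne_zero.2 ⟨by exact_mod_cast hε.ne', by finiteness⟩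
    have hnε : (n : ℝ≥0∞) * (ε / (n + 1)) ≤ ε := by
      rw [← mul_div_assoc]
      refine ENNReal.div_le_of_le_mul ?_
      rw [mul_comm]
      gcongr
      exact le_self_add
    obtain ⟨σ, hσ, hle⟩ := exists_isMaxStrategy_le_stateProb (G := G) top n hε'
    rw [← tsub_le_iff_right]
    refine le_iSup₂_of_le σ hσ (le_iInf₂ fun π hπ => tsub_le_iff_right.2 ?_)
    rw [(hP σ π s hσ hπ).measure_reachesWithin htop]
    exact (hle π hπ s).trans (by gcongr)

lemma stepValue_iSup (hB : (G.actB s).Finite) {v : ℕ → S → ℝ≥0∞} (hv : Monotone v) :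
    G.stepValue (fun t => ⨆ n, v n t) s = ⨆ n, G.stepValue (v n) s := by
  have := hB.to_subtype
  simp only [stepValue, expE_iSup _ hv, iInf_subtype']
  rw [iSup_comm]
  refine iSup_congr fun α => ?_
  rw [iSup_comm]
  refine iSup_congr fun _ => (iSup_iInf_of_monotone fun b m n hmn => ?_).symm
  exact expE_mono (hv hmn)

lemma val_mono {P : (Hist S A B → PMF A) → (Hist S A B → PMF B) → S → Measure (Play S A B)}
    {E F : Set (Play S A B)} (h : E ⊆ F) (s : S) : G.val P E s ≤ G.val P F s :=
  iSup₂_mono fun _ _ => iInf₂_mono fun _ _ => measure_mono h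

end Game

/-- Lemma 2: the limit v_∞ of the horizon-restricted values is a
fixed point of the one-step (sup over mixed Max actions, min over Min actions)
operator. -/
theorem stmt10 {S A B : Type} [Countable S] [Countable A] [Countable B]
    (G : Game S A B) (top : S) (htop : G.IsSink top)
    (hB : ∀ s, (G.actB s).Finite)
    (P : (Hist S A B → PMF A) → (Hist S A B → PMF B) → S →
      MeasureTheory.Measure (Play S A B))
    (hP : ∀ σ π s, G.IsMaxStrategy σ → G.IsMinStrategy π →
      G.IsPlayMeasure σ π s (P σ π s))
    (vinf : S → ℝ≥0∞)
    (hvinf : ∀ s : S, Filter.Tendsto (fun n => G.val P (ReachesWithin top n) s)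
      Filter.atTop (nhds (vinf s))) :
    ∀ s : S, vinf s =
      ⨆ α ∈ {α : PMF A | α.support ⊆ G.actA s},
        ⨅ b ∈ G.actB s, expE (G.pA s α b) vinf := by
  have hmono : Monotone (G.horizonValue top) := fun m n hmn s => by
    simpa only [Game.val_reachesWithin htop hB hP] using
      Game.val_mono (G := G) (P := P) (reachesWithin_mono top hmn) s
  have hlim : vinf = fun s => ⨆ n, G.horizonValue top n s := funext fun s => by
    refine tendsto_nhds_unique (hvinf s) ?_
    simp only [Game.val_reachesWithin htop hB hP]
    exact tendsto_atTop_iSup fun m n hmn => hmono hmn s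
  intro s
  calc vinf s = ⨆ n, G.horizonValue top (n + 1) s := by
        rw [hlim]
        exact (Monotone.iSup_nat_add (fun m n hmn => hmono hmn s) 1).symm
    _ = G.stepValue vinf s := by
        rw [hlim, Game.stepValue_iSup (hB s) hmono]
        rfl
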